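/- The digit map D : X⁻¹O ∩ ᶜK → (A∖k)^{ℕ≥1}, D(ξ) = (a_n(ξ))_{n≥1}, is a homeomorphism (for the d_∞-topology on the source and the product of discrete topologies on the target) satisfying D ∘ Ψ = σ ∘ D, where σ is the one-sided left shift, and the pushforward of the probability measure q·μ|_{X⁻¹O ∩ ᶜK} under D is the Bernoulli product measure ν^⊗ℕ; in other words, the Artin continued fraction digits of a Haar-random element of X⁻¹O are independent and identically distributed with law ν. -/

import Mathlib

open MeasureTheory
open scoped ENNReal Classical

noncomputable section

namespace ArtinCoding

variable (k : Type*) [Field k] [Fintype k]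

/-- The field `K̂ = k((X⁻¹))` of formal Laurent series in `X⁻¹` over `k`, realized as the
field of formal Laurent series `k((t))` in the variable `t = X⁻¹`. -/
abbrev Khat := LaurentSeries k

variable {k}

/-- The absolute value `|f|_∞ = q^{-v_∞(f)}`, where `v_∞` is the order of vanishing in the
variable `t = X⁻¹` (so a nonzero polynomial in `X` has absolute value `≥ 1`). -/
def absInf (f : Khat k) : ℝ :=
  if f = 0 then 0 else (Fintype.card k : ℝ) ^ (-f.order)

lemma absInf_nonneg (f : Khat k) : 0 ≤ absInf f := by
  unfold absInf
  split
  · exact le_refl 0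
  · positivity

lemma absInf_eq_zero {f : Khat k} : absInf f = 0 ↔ f = 0 := by
  constructor
  · intro h
    by_contra hf
    have hq : (0:ℝ) < (Fintype.card k : ℝ) := by
      have := Fintype.card_pos (α := k); positivity
    rw [absInf, if_neg hf] at h
    exact absurd h (ne_of_gt (zpow_pos hq _))
  · intro h; simp [absInf, h]

lemma absInf_neg (f : Khat k) : absInf (-f) = absInf f := by
  unfold absInf
  rw [neg_eq_zero, HahnSeries.order_neg]

lemma absInf_add_le (f g : Khat k) : absInf (f + g) ≤ max (absInf f) (absInf g) := by
  rcases eq_or_ne (f + g) 0 with h | h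
  · rw [show absInf (f+g) = 0 by rw [absInf_eq_zero]; exact h]
    exact le_max_of_le_left (absInf_nonneg f)
  rcases eq_or_ne f 0 with hf | hf
  · simp [hf]
  rcases eq_or_ne g 0 with hg | hg
  · simp [hg]
  have hmin := HahnSeries.min_order_le_order_add h
  have hq : (1:ℝ) ≤ (Fintype.card k : ℝ) := by
    exact_mod_cast Nat.one_le_iff_ne_zero.mpr Fintype.card_ne_zero
  rw [absInf, if_neg h]
  rcases le_total f.order g.order with hod | hod
  · rw [min_eq_left hod] at hmin
    refine le_max_of_le_left ?_
    rw [absInf, if_neg hf]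
    exact zpow_le_zpow_right₀ hq (neg_le_neg hmin)
  · rw [min_eq_right hod] at hmin
    refine le_max_of_le_right ?_
    rw [absInf, if_neg hg]
    exact zpow_le_zpow_right₀ hq (neg_le_neg hmin)

/-- The metric `d_∞(f,g) = |f-g|_∞` on `K̂`. -/
noncomputable instance : MetricSpace (Khat k) where
  dist f g := absInf (f - g)
  dist_self f := by simp [absInf]
  dist_comm f g := by
    have : g - f = -(f - g) := by ring
    show absInf (f - g) = absInf (g - f)
    rw [this, absInf_neg]
  dist_triangle f g h := by
    show absInf (f - h) ≤ absInf (f - g) + absInf (g - h)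
    have key : absInf (f - h) ≤ max (absInf (f - g)) (absInf (g - h)) := by
      have : f - h = (f - g) + (g - h) := by ring
      rw [this]; exact absInf_add_le _ _
    exact key.trans (max_le_add_of_nonneg (absInf_nonneg _) (absInf_nonneg _))
  eq_of_dist_eq_zero := by
    intro f g h
    have : f - g = 0 := absInf_eq_zero.mp h
    exact sub_eq_zero.mp this

/- Make sure the topology coming from the metric `d_∞` is the one used everywhere
(the valued-field uniformity on Laurent series induces the same topology). -/
instance (priority := 10000) : UniformSpace (Khat k) := PseudoMetricSpace.toUniformSpace
instance (priority := 10000) : TopologicalSpace (Khat k) := UniformSpace.toTopologicalSpace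

instance : MeasurableSpace (Khat k) := borel _
instance : BorelSpace (Khat k) := ⟨rfl⟩

variable (k)

/-- The element `X⁻¹` of `K̂` (the uniformizer `t`). -/
def Xinv : Khat k := HahnSeries.single (1 : ℤ) (1 : k)

/-- The element `X` of `K̂`. -/
def Xel : Khat k := HahnSeries.single (-1 : ℤ) (1 : k)

/-- The valuation ring `O = k[[X⁻¹]] = {f : |f|_∞ ≤ 1}`. -/
def Oball : Set (Khat k) := {f | absInf f ≤ 1}

/-- The set `X⁻¹O`, i.e. the maximal ideal of `O`. -/
def XinvO : Set (Khat k) := (fun f => Xinv k * f) '' Oball k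

/-- The ring `A = k[X]` of polynomials in `X`, viewed as a subset of `K̂`. -/
def Aset : Set (Khat k) := Set.range fun p : Polynomial k => Polynomial.aeval (Xel k) p

/-- The constants `k ⊆ K̂`. -/
def kconsts : Set (Khat k) := Set.range (algebraMap k (Khat k))

/-- The set `A∖k` of nonconstant polynomials in `X`, viewed inside `K̂`. -/
def AmK : Set (Khat k) := Aset k \ kconsts k

/-- The field `K = k(X)` of rational functions, viewed as a subset of `K̂`
(note that `k(X) = k(X⁻¹)` as a subfield of `K̂`). -/
def Kset : Set (Khat k) := Set.range fun r : RatFunc k => (r : LaurentSeries k)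

/-- The set `ᶜK = K̂ ∖ K` of irrational elements. -/
def cK : Set (Khat k) := (Kset k)ᶜ

variable {k}

/-- The integer part `[f] ∈ A = k[X]` of `f ∈ K̂`: the sum of the terms of `f` with
nonpositive exponents in `t = X⁻¹`. -/
def intPart (f : Khat k) : Khat k :=
  ∑ i ∈ Finset.Icc (min f.order 0) 0, HahnSeries.single i (f.coeff i)

/-- The fractional part `{f} = f - [f] ∈ X⁻¹O` of `f ∈ K̂`. -/
def fracPart (f : Khat k) : Khat k := f - intPart f

/-- The Artin map `Ψ(f) = 1/f - [1/f]`. -/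
def ArtinPsi (f : Khat k) : Khat k := fracPart f⁻¹

/-- The Artin continued fraction digit `a_{n+1}(f) = [1/Ψⁿ(f)]` (for `n : ℕ`, so that
`digit 0 f = a₁(f) = [1/f]`). -/
def digit (n : ℕ) (f : Khat k) : Khat k := intPart ((ArtinPsi (k := k))^[n] f)⁻¹

variable (k)

/-- The set `J = ⋃_{a ∈ A∖k} (a + X⁻¹O)`. -/
def Jset : Set (Khat k) := ⋃ a ∈ AmK k, (fun x => a + x) '' XinvO k

/-- The domain `Ω = (J ∩ ᶜK) × (X⁻¹O ∩ ᶜK)` of the natural extension of the Artin map. -/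
def OmegaSet : Set (Khat k × Khat k) := (Jset k ∩ cK k) ×ˢ (XinvO k ∩ cK k)

variable {k}

/-- The map `Φ(ξ₋, ξ₊) = (1/ξ₋ - [1/ξ₊], Ψ(ξ₊))` (as a globally defined map on `K̂ × K̂`). -/
def PhiRaw (p : Khat k × Khat k) : Khat k × Khat k :=
  (p.1⁻¹ - intPart p.2⁻¹, ArtinPsi p.2)

/-- The coding map `Θ'` sending `(ξ₋, ξ₊)` to the bilateral sequence `(c_n)_{n ∈ ℤ}` with
`c_n = a_n(ξ₊)` for `n ≥ 1` and `c_{-n} = a_{n+1}(-1/ξ₋)` for `n ≥ 0`. -/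
def ThetaRaw (p : Khat k × Khat k) : ℤ → Khat k := fun n =>
  if 1 ≤ n then digit (n - 1).toNat p.2 else digit (-n).toNat (-p.1⁻¹)

variable (k)

/-- The density `q²/|ξ₊ - ξ₋|²_∞`. -/
def dens (p : Khat k × Khat k) : ℝ≥0∞ :=
  ENNReal.ofReal ((Fintype.card k : ℝ) ^ 2 * ((absInf (p.2 - p.1)) ^ 2)⁻¹)

/-- The measure `m̂` on `Ω` given by `dm̂(ξ₋,ξ₊) = q² dμ(ξ₋) dμ(ξ₊)/|ξ₊ - ξ₋|²_∞`. -/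
def mhat (μ : Measure (Khat k)) : Measure (Khat k × Khat k) :=
  (((μ.prod μ).withDensity (dens k))).restrict (OmegaSet k)

/-- The weight `ν(a) = |a|_∞⁻² = q^{-2 deg a}` for `a ∈ A∖k` (and `0` otherwise),
with values in `ℝ≥0∞`. -/
def nuE (a : Khat k) : ℝ≥0∞ :=
  if a ∈ AmK k then ENNReal.ofReal (((absInf a) ^ 2)⁻¹) else 0

variable {k}

lemma one_lt_card : (1 : ℝ) < (Fintype.card k : ℝ) := by
  exact_mod_cast Fintype.one_lt_card

lemma card_pos : (0 : ℝ) < (Fintype.card k : ℝ) := zero_lt_one.trans one_lt_card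

lemma absInf_of_ne {f : Khat k} (hf : f ≠ 0) :
    absInf f = (Fintype.card k : ℝ) ^ (-f.order) := if_neg hf

@[simp] lemma absInf_zero : absInf (0 : Khat k) = 0 := absInf_eq_zero.mpr rfl

@[simp] lemma absInf_one : absInf (1 : Khat k) = 1 := by
  rw [absInf_of_ne one_ne_zero]; simp

lemma absInf_pos {f : Khat k} (hf : f ≠ 0) : 0 < absInf f :=
  (absInf_nonneg f).lt_of_ne' (mt absInf_eq_zero.mp hf)

lemma absInf_mul (f g : Khat k) : absInf (f * g) = absInf f * absInf g := by
  rcases eq_or_ne f 0 with rfl | hf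
  · simp
  rcases eq_or_ne g 0 with rfl | hg
  · simp
  rw [absInf_of_ne hf, absInf_of_ne hg, absInf_of_ne (mul_ne_zero hf hg),
    HahnSeries.order_mul hf hg, neg_add, zpow_add₀ card_pos.ne']

lemma absInf_inv (f : Khat k) : absInf f⁻¹ = (absInf f)⁻¹ := by
  rcases eq_or_ne f 0 with rfl | hf
  · simp
  · refine eq_inv_of_mul_eq_one_left ?_
    rw [← absInf_mul, inv_mul_cancel₀ hf, absInf_one]

lemma absInf_sub_comm (f g : Khat k) : absInf (f - g) = absInf (g - f) := by
  rw [← absInf_neg, neg_sub]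

lemma absInf_sub_le (f g : Khat k) : absInf (f - g) ≤ max (absInf f) (absInf g) := by
  simpa [sub_eq_add_neg, absInf_neg] using absInf_add_le f (-g)

lemma absInf_sub_le_max_sub (f g h : Khat k) :
    absInf (f - h) ≤ max (absInf (f - g)) (absInf (g - h)) := by
  simpa using absInf_add_le (f - g) (g - h)

lemma absInf_add_eq_left {f g : Khat k} (h : absInf g < absInf f) :
    absInf (f + g) = absInf f := by
  refine le_antisymm ((absInf_add_le f g).trans (max_le le_rfl h.le)) ?_
  have := absInf_sub_le (f + g) g
  rw [add_sub_cancel_right] at this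
  exact (le_max_iff.mp this).resolve_right h.not_ge

/-- `|f|_∞ < q^{-n}` means that all coefficients of `f` of index at most `n` vanish. -/
lemma absInf_lt_zpow_iff {f : Khat k} {n : ℤ} :
    absInf f < (Fintype.card k : ℝ) ^ (-n) ↔ ∀ i ≤ n, f.coeff i = 0 := by
  rcases eq_or_ne f 0 with rfl | hf
  · simpa using zpow_pos card_pos (-n)
  rw [absInf_of_ne hf, zpow_lt_zpow_iff_right₀ one_lt_card, neg_lt_neg_iff]
  refine ⟨fun h i hi => HahnSeries.coeff_eq_zero_of_lt_order (hi.trans_lt h), fun h => ?_⟩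
  by_contra! hn
  exact hf (HahnSeries.coeff_order_eq_zero.mp (h _ hn))

lemma absInf_lt_one_iff {f : Khat k} : absInf f < 1 ↔ ∀ i ≤ 0, f.coeff i = 0 := by
  simpa using absInf_lt_zpow_iff (f := f) (n := 0)

/-- The values of `|·|_∞` are discrete. -/
lemma absInf_lt_zpow_add_one_iff {f : Khat k} {n : ℤ} :
    absInf f < (Fintype.card k : ℝ) ^ (n + 1) ↔ absInf f ≤ (Fintype.card k : ℝ) ^ n := by
  rcases eq_or_ne f 0 with rfl | hf
  · simp [zpow_pos card_pos, (zpow_pos card_pos _).le]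
  rw [absInf_of_ne hf, zpow_lt_zpow_iff_right₀ one_lt_card, zpow_le_zpow_iff_right₀ one_lt_card,
    Int.lt_add_one_iff]

lemma absInf_single {n : ℤ} {a : k} (ha : a ≠ 0) :
    absInf (HahnSeries.single n a : Khat k) = (Fintype.card k : ℝ) ^ (-n) := by
  rw [absInf_of_ne (by simpa using ha), HahnSeries.order_single ha]

lemma mem_XinvO_iff {f : Khat k} : f ∈ XinvO k ↔ absInf f < 1 := by
  have hX : absInf (Xinv k) = (Fintype.card k : ℝ)⁻¹ := by
    simpa [Xinv] using absInf_single (k := k) (n := 1) one_ne_zero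
  have hX0 : Xinv k ≠ 0 := by simp [Xinv]
  have key : absInf f < 1 ↔ absInf f ≤ (Fintype.card k : ℝ)⁻¹ := by
    simpa using absInf_lt_zpow_add_one_iff (f := f) (n := -1)
  rw [key]
  constructor
  · rintro ⟨g, hg, rfl⟩
    simp only [absInf_mul, hX]
    exact mul_le_of_le_one_right (inv_nonneg.mpr card_pos.le) hg
  · intro h
    refine ⟨(Xinv k)⁻¹ * f, ?_, mul_inv_cancel_left₀ hX0 f⟩
    change absInf ((Xinv k)⁻¹ * f) ≤ 1
    rw [absInf_mul, absInf_inv, hX, inv_inv]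
    exact (mul_le_mul_of_nonneg_left h card_pos.le).trans_eq (mul_inv_cancel₀ card_pos.ne')

lemma coeff_intPart {F : Type*} [Field F] (f : Khat F) (i : ℤ) :
    (intPart f).coeff i = if i ≤ 0 then f.coeff i else 0 := by
  rw [intPart, HahnSeries.coeff_sum]
  by_cases hi : i ∈ Finset.Icc (min f.order 0) 0
  · rw [Finset.sum_eq_single_of_mem i hi fun j _ hj =>
      HahnSeries.coeff_single_of_ne hj.symm, HahnSeries.coeff_single_same,
      if_pos (Finset.mem_Icc.mp hi).2]
  · rw [Finset.sum_eq_zero fun j hj =>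
      HahnSeries.coeff_single_of_ne (ne_of_mem_of_not_mem hj hi).symm]
    split_ifs with h0
    · refine (HahnSeries.coeff_eq_zero_of_lt_order ?_).symm
      simp only [Finset.mem_Icc] at hi
      omega
    · rfl

lemma algebraMap_mul_Xel_pow {F : Type*} [Field F] (c : F) (n : ℕ) :
    algebraMap F (Khat F) c * Xel F ^ n = HahnSeries.single (-(n : ℤ)) c := by
  simp [Xel, HahnSeries.single_pow, HahnSeries.algebraMap_apply', HahnSeries.C_apply]

lemma mem_Aset_iff {F : Type*} [Field F] {f : Khat F} :
    f ∈ Aset F ↔ ∀ i, 0 < i → f.coeff i = 0 := by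
  constructor
  · rintro ⟨p, rfl⟩ i hi
    simp only [Polynomial.aeval_eq_sum_range, HahnSeries.coeff_sum, Algebra.smul_def,
      algebraMap_mul_Xel_pow]
    exact Finset.sum_eq_zero fun n _ => HahnSeries.coeff_single_of_ne (by omega)
  · intro h
    refine ⟨∑ i ∈ Finset.range ((-f.order).toNat + 1),
      Polynomial.monomial i (f.coeff (-(i : ℤ))), ?_⟩
    simp only [map_sum, Polynomial.aeval_monomial, algebraMap_mul_Xel_pow]
    ext j
    rw [HahnSeries.coeff_sum]
    rcases lt_or_ge 0 j with hj | hj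
    · rw [h j hj]
      exact Finset.sum_eq_zero fun n _ => HahnSeries.coeff_single_of_ne (by omega)
    · rw [Finset.sum_eq_single (-j).toNat]
      · simp [Int.toNat_of_nonneg (neg_nonneg.mpr hj)]
      · exact fun b _ hb => HahnSeries.coeff_single_of_ne (by omega)
      · intro hb
        rw [Int.toNat_of_nonneg (neg_nonneg.mpr hj), neg_neg, HahnSeries.coeff_single_same]
        refine HahnSeries.coeff_eq_zero_of_lt_order ?_
        simp only [Finset.mem_range, not_lt] at hb
        omega

lemma mul_mem_Aset {F : Type*} [Field F] {f g : Khat F} (hf : f ∈ Aset F) (hg : g ∈ Aset F) :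
    f * g ∈ Aset F := by
  obtain ⟨p, rfl⟩ := hf
  obtain ⟨r, rfl⟩ := hg
  exact ⟨p * r, map_mul _ _ _⟩

lemma sub_mem_Aset {F : Type*} [Field F] {f g : Khat F} (hf : f ∈ Aset F) (hg : g ∈ Aset F) :
    f - g ∈ Aset F := by
  obtain ⟨p, rfl⟩ := hf
  obtain ⟨r, rfl⟩ := hg
  exact ⟨p - r, map_sub _ _ _⟩

lemma intPart_mem_Aset {F : Type*} [Field F] (f : Khat F) : intPart f ∈ Aset F :=
  mem_Aset_iff.mpr fun i hi => by rw [coeff_intPart, if_neg hi.not_ge]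

lemma absInf_fracPart_lt_one (f : Khat k) : absInf (fracPart f) < 1 :=
  absInf_lt_one_iff.mpr fun i hi => by
    rw [fracPart, HahnSeries.coeff_sub, coeff_intPart, if_pos hi, sub_self]

lemma eq_zero_of_mem_Aset {f : Khat k} (hf : f ∈ Aset k) (h : absInf f < 1) : f = 0 := by
  ext i
  rcases le_or_gt i 0 with hi | hi
  · exact absInf_lt_one_iff.mp h i hi
  · exact mem_Aset_iff.mp hf i hi

lemma intPart_eq_iff {f a : Khat k} (ha : a ∈ Aset k) : intPart f = a ↔ absInf (f - a) < 1 := by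
  constructor
  · rintro rfl
    exact absInf_fracPart_lt_one f
  · intro h
    refine sub_eq_zero.mp (eq_zero_of_mem_Aset (sub_mem_Aset (intPart_mem_Aset f) ha) ?_)
    refine (absInf_sub_le_max_sub _ f _).trans_lt (max_lt ?_ h)
    rw [absInf_sub_comm]
    exact absInf_fracPart_lt_one f

lemma mem_AmK_iff {f : Khat k} : f ∈ AmK k ↔ f ∈ Aset k ∧ 1 < absInf f := by
  refine and_congr_right fun hf => ?_
  rw [← not_le, not_iff_not]
  constructor
  · rintro ⟨c, rfl⟩
    rw [HahnSeries.algebraMap_apply']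
    rcases eq_or_ne c 0 with rfl | hc
    · simp
    · simp [HahnSeries.C_apply, absInf_single hc]
  · intro h
    refine ⟨f.coeff 0, ?_⟩
    have h' := absInf_lt_zpow_iff.mp
      ((absInf_lt_zpow_add_one_iff (f := f) (n := 0)).mpr (by simpa using h) |>.trans_eq
        (by simp : _ = (Fintype.card k : ℝ) ^ (-(-1) : ℤ)))
    ext i
    rcases lt_trichotomy i 0 with hi | rfl | hi
    · rw [h' i (by omega)]
      simp [HahnSeries.C_apply, HahnSeries.coeff_single_of_ne hi.ne, HahnSeries.algebraMap_apply']
    · simp [HahnSeries.algebraMap_apply']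
    · rw [mem_Aset_iff.mp hf i hi]
      simp [HahnSeries.C_apply, HahnSeries.coeff_single_of_ne hi.ne', HahnSeries.algebraMap_apply']

lemma card_le_absInf_of_mem_AmK {a : Khat k} (ha : a ∈ AmK k) :
    (Fintype.card k : ℝ) ≤ absInf a := by
  by_contra! h
  have := (absInf_lt_zpow_add_one_iff (f := a) (n := 0)).mp (by simpa using h)
  exact (mem_AmK_iff.mp ha).2.not_ge (by simpa using this)

lemma ne_zero_of_mem_AmK {a : Khat k} (ha : a ∈ AmK k) : a ≠ 0 := by
  rintro rfl
  exact zero_lt_one.not_gt ((mem_AmK_iff.mp ha).2.trans_eq absInf_zero)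

lemma absInf_eq_of_sub_lt {f a : Khat k} (h : absInf (f - a) < absInf a) :
    absInf f = absInf a := by
  simpa using absInf_add_eq_left h

/-- The cylinder of first digit `a` together with a ball condition on `Ψ ξ` is a ball. -/
lemma intPart_inv_eq_and_absInf_ArtinPsi_sub_lt_iff {a y ξ : Khat k} {r : ℝ} (ha : a ∈ AmK k)
    (hy : absInf y < 1) (hr : r ≤ 1) :
    intPart ξ⁻¹ = a ∧ absInf (ArtinPsi ξ - y) < r ↔
      absInf (ξ - (a + y)⁻¹) < r / absInf a ^ 2 := by
  obtain ⟨haA, ha1⟩ := mem_AmK_iff.mp ha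
  have ha0 : 0 < absInf a := zero_lt_one.trans ha1
  have hay : absInf (a + y) = absInf a := absInf_add_eq_left (hy.trans ha1)
  have hay0 : a + y ≠ 0 := fun h => by simp [h] at hay; exact ha0.ne hay
  have key : ξ ≠ 0 → absInf ξ = (absInf a)⁻¹ →
      absInf (ξ - (a + y)⁻¹) = absInf (ξ⁻¹ - a - y) / absInf a ^ 2 := by
    intro hξ hξa
    have : ξ - (a + y)⁻¹ = -((ξ⁻¹ - a - y) * (ξ * (a + y)⁻¹)) := by
      field_simp
      ring
    rw [this, absInf_neg, absInf_mul, absInf_mul, absInf_inv, hay, hξa]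
    field_simp
  constructor
  · rintro ⟨rfl, h⟩
    have h1 : absInf ξ⁻¹ = absInf (intPart ξ⁻¹) :=
      absInf_eq_of_sub_lt ((absInf_fracPart_lt_one _).trans ha1)
    have hξ : ξ ≠ 0 := by
      rintro rfl
      rw [← h1, inv_zero, absInf_zero] at ha0
      exact ha0.false
    rw [key hξ (by rw [← h1, absInf_inv, inv_inv])]
    exact div_lt_div_of_pos_right h (by positivity)
  · intro h
    have hlt : absInf (ξ - (a + y)⁻¹) < absInf (a + y)⁻¹ := by
      refine h.trans_le ?_
      rw [absInf_inv, hay, div_le_iff₀ (by positivity)]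
      have : (absInf a)⁻¹ * absInf a ^ 2 = absInf a := by field_simp
      linarith
    have hξa := absInf_eq_of_sub_lt hlt
    rw [absInf_inv, hay] at hξa
    have hξ : ξ ≠ 0 := fun h0 => by
      rw [h0, absInf_zero] at hξa
      exact (inv_pos.mpr ha0).ne hξa
    rw [key hξ hξa, div_lt_div_iff_of_pos_right (by positivity)] at h
    have hint : intPart ξ⁻¹ = a := (intPart_eq_iff haA).mpr <| by
      simpa using (absInf_add_le (ξ⁻¹ - a - y) y).trans_lt (max_lt (h.trans_le hr) hy)
    refine ⟨hint, ?_⟩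
    rwa [ArtinPsi, fracPart, hint]

/-- The finite continued fraction `1/(c₀ + 1/(c₁ + ⋯ + 1/c_{n-1}))`. -/
def convergent : ℕ → (ℕ → Khat k) → Khat k
  | 0, _ => 0
  | n + 1, c => (c 0 + convergent n fun i => c (i + 1))⁻¹

/-- The radius of the cylinder of first `n` digits `c₀, …, c_{n-1}`. -/
def cylRadius (n : ℕ) (c : ℕ → Khat k) : ℝ := ∏ i ∈ Finset.range n, (absInf (c i) ^ 2)⁻¹

lemma cylRadius_succ (n : ℕ) (c : ℕ → Khat k) :
    cylRadius (n + 1) c = cylRadius n (fun i => c (i + 1)) / absInf (c 0) ^ 2 := by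
  rw [cylRadius, Finset.prod_range_succ', div_eq_mul_inv, cylRadius]

lemma absInf_convergent_lt_one {n : ℕ} {c : ℕ → Khat k} (hc : ∀ i < n, c i ∈ AmK k) :
    absInf (convergent n c) < 1 := by
  induction n generalizing c with
  | zero => simp [convergent]
  | succ n ih =>
    have h1 := (mem_AmK_iff.mp (hc 0 n.succ_pos)).2
    have := ih (c := fun i => c (i + 1)) fun i hi => hc _ (by omega)
    rw [convergent, absInf_inv, absInf_add_eq_left (this.trans h1)]
    exact inv_lt_one_of_one_lt₀ h1

lemma cylRadius_pos {n : ℕ} {c : ℕ → Khat k} (hc : ∀ i < n, c i ∈ AmK k) :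
    0 < cylRadius n c :=
  Finset.prod_pos fun i hi => inv_pos.mpr <|
    pow_pos (absInf_pos (ne_zero_of_mem_AmK (hc i (Finset.mem_range.mp hi)))) 2

lemma cylRadius_le {n : ℕ} {c : ℕ → Khat k} (hc : ∀ i < n, c i ∈ AmK k) :
    cylRadius n c ≤ ((Fintype.card k : ℝ)⁻¹) ^ n := by
  rw [cylRadius, ← Finset.card_range n, ← Finset.prod_const, Finset.card_range]
  refine Finset.prod_le_prod (fun _ _ => inv_nonneg.mpr (sq_nonneg _)) fun i hi => ?_
  have h := card_le_absInf_of_mem_AmK (hc i (Finset.mem_range.mp hi))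
  refine inv_anti₀ card_pos (h.trans (le_self_pow₀ (one_lt_card.le.trans h) two_ne_zero))

lemma cylRadius_le_one {n : ℕ} {c : ℕ → Khat k} (hc : ∀ i < n, c i ∈ AmK k) :
    cylRadius n c ≤ 1 :=
  (cylRadius_le hc).trans (pow_le_one₀ (inv_nonneg.mpr card_pos.le)
    (inv_le_one_of_one_le₀ one_lt_card.le))

lemma forall_digit_eq_iff {n : ℕ} {c : ℕ → Khat k} (hc : ∀ i < n, c i ∈ AmK k) {ξ : Khat k}
    (hξ : absInf ξ < 1) :
    (∀ i < n, digit i ξ = c i) ↔ absInf (ξ - convergent n c) < cylRadius n c := by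
  induction n generalizing c ξ with
  | zero => simpa [convergent, cylRadius] using hξ
  | succ n ih =>
    have hc' : ∀ i < n, c (i + 1) ∈ AmK k := fun i hi => hc _ (by omega)
    rw [cylRadius_succ, convergent, ← intPart_inv_eq_and_absInf_ArtinPsi_sub_lt_iff
      (hc 0 n.succ_pos) (absInf_convergent_lt_one hc') (cylRadius_le_one hc'),
      ← ih (ξ := ArtinPsi ξ) hc' (absInf_fracPart_lt_one _)]
    constructor
    · exact fun h => ⟨h 0 n.succ_pos, fun i hi => h (i + 1) (by omega)⟩
    · rintro ⟨h0, h⟩ (_ | i) hi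
      · exact h0
      · exact h i (by omega)

lemma absInf_convergent_sub_convergent_lt {m n : ℕ} (hmn : n ≤ m) {c : ℕ → Khat k}
    (hc : ∀ i < m, c i ∈ AmK k) :
    absInf (convergent m c - convergent n c) < cylRadius n c := by
  induction n generalizing c m with
  | zero => simpa [convergent, cylRadius] using absInf_convergent_lt_one hc
  | succ n ih =>
    obtain ⟨m, rfl⟩ : ∃ m', m = m' + 1 := ⟨m - 1, by omega⟩
    have hc' : ∀ i < m, c (i + 1) ∈ AmK k := fun i hi => hc _ (by omega)
    have hcn : ∀ i < n, c (i + 1) ∈ AmK k := fun i hi => hc _ (by omega)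
    have hy := absInf_convergent_lt_one hc'
    have hint : intPart (convergent (m + 1) c)⁻¹ = c 0 := by
      rw [intPart_eq_iff (hc 0 m.succ_pos).1, convergent, inv_inv, add_sub_cancel_left]
      exact hy
    have hΨ : ArtinPsi (convergent (m + 1) c) = convergent m fun i => c (i + 1) := by
      rw [ArtinPsi, fracPart, hint, convergent, inv_inv, add_sub_cancel_left]
    rw [cylRadius_succ, convergent.eq_2 c n,
      ← intPart_inv_eq_and_absInf_ArtinPsi_sub_lt_iff (hc 0 m.succ_pos)
      (absInf_convergent_lt_one hcn) (cylRadius_le_one hcn), hΨ]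
    exact ⟨hint, ih (by omega) hc'⟩

/-- The Laurent series supported on positive indices with prescribed coefficients. -/
def ofCoeff (F : Type*) [Field F] (g : ℕ → F) : Khat F :=
  HahnSeries.single 1 1 * HahnSeries.ofPowerSeries ℤ F (PowerSeries.mk fun n => g (n + 1))

lemma coeff_ofCoeff {F : Type*} [Field F] (g : ℕ → F) (n : ℕ) :
    (ofCoeff F g).coeff ((n : ℤ) + 1) = g (n + 1) := by
  rw [ofCoeff, add_comm, HahnSeries.coeff_single_mul, add_sub_cancel_left, one_mul,
    HahnSeries.ofPowerSeries_apply_coeff, PowerSeries.coeff_mk]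

lemma coeff_ofCoeff_of_nonpos {F : Type*} [Field F] (g : ℕ → F) {i : ℤ} (hi : i ≤ 0) :
    (ofCoeff F g).coeff i = 0 := by
  rw [ofCoeff, HahnSeries.coeff_single_mul, one_mul, PowerSeries.coeff_coe, if_pos (by omega)]

lemma exists_forall_digit_eq {c : ℕ → Khat k} (hc : ∀ i, c i ∈ AmK k) :
    ∃ ξ : Khat k, absInf ξ < 1 ∧ ∀ n, digit n ξ = c n := by
  set ξ := ofCoeff k fun i => (convergent i c).coeff i with hξ
  have h1 : absInf ξ < 1 := absInf_lt_one_iff.mpr fun i hi => coeff_ofCoeff_of_nonpos _ hi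
  have hlt : ∀ n : ℕ, absInf (ξ - convergent n c) < (Fintype.card k : ℝ) ^ (-(n : ℤ)) := by
    intro n
    refine absInf_lt_zpow_iff.mpr fun i hi => ?_
    rw [HahnSeries.coeff_sub]
    rcases le_or_gt i 0 with h0 | h0
    · rw [absInf_lt_one_iff.mp h1 i h0,
        absInf_lt_one_iff.mp (absInf_convergent_lt_one fun i _ => hc i) i h0, sub_zero]
    · obtain ⟨j, rfl⟩ : ∃ j : ℕ, i = (j : ℤ) + 1 := ⟨(i - 1).toNat, by omega⟩
      rw [hξ, coeff_ofCoeff]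
      have := (absInf_convergent_sub_convergent_lt (n := j + 1) (m := n) (by omega)
        fun i _ => hc i).trans_le (cylRadius_le fun i _ => hc i)
      rw [inv_pow, ← zpow_natCast, ← zpow_neg] at this
      have := absInf_lt_zpow_iff.mp this (j + 1) (by simp)
      rw [HahnSeries.coeff_sub] at this
      rw [← neg_sub]
      push_cast
      rw [this, neg_zero]
  refine ⟨ξ, h1, fun n => ?_⟩
  refine (forall_digit_eq_iff (n := n + 1) (fun i _ => hc i) h1).mpr ?_ n n.lt_succ_self
  obtain ⟨m, hm⟩ := exists_pow_lt_of_lt_one (cylRadius_pos (n := n + 1) fun i _ => hc i)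
    (inv_lt_one_of_one_lt₀ (one_lt_card (k := k)))
  refine (absInf_sub_le_max_sub _ (convergent (max m (n + 1)) c) _).trans_lt (max_lt ?_
    (absInf_convergent_sub_convergent_lt (le_max_right _ _) fun i _ => hc i))
  refine (hlt _).trans_le (le_trans ?_ hm.le)
  rw [zpow_neg, zpow_natCast, ← inv_pow]
  exact pow_le_pow_of_le_one (inv_nonneg.mpr card_pos.le)
    (inv_le_one_of_one_le₀ one_lt_card.le) (le_max_left _ _)

section RationalFunctions

open scoped RatFunc

lemma Kset_eq (F : Type*) [Field F] :
    Kset F = (algebraMap (RatFunc F) (Khat F)).fieldRange := rfl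

lemma algebraMap_ratFunc_algebraMap {F : Type*} [Field F] (p : Polynomial F) :
    algebraMap (RatFunc F) (Khat F) (algebraMap _ _ p) =
      HahnSeries.ofPowerSeries ℤ F (p : PowerSeries F) :=
  (RatFunc.coe_coe p).symm

lemma Aset_subset_Kset (F : Type*) [Field F] : Aset F ⊆ Kset F := by
  rintro _ ⟨p, rfl⟩
  have hX : Xel F ∈ (algebraMap (RatFunc F) (Khat F)).fieldRange := by
    refine ⟨RatFunc.X⁻¹, ?_⟩
    rw [map_inv₀, RatFunc.coe_X, Xel, HahnSeries.inv_single, inv_one]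
  rw [Kset_eq, SetLike.mem_coe]
  simp only [Polynomial.aeval_eq_sum_range, Algebra.smul_def]
  refine sum_mem fun i _ => mul_mem
    ⟨algebraMap _ _ (Polynomial.C (p.coeff i)), ?_⟩ (pow_mem hX i)
  rw [algebraMap_ratFunc_algebraMap, Polynomial.coe_C, HahnSeries.algebraMap_apply',
    PowerSeries.algebraMap_apply, Algebra.algebraMap_self_apply, HahnSeries.ofPowerSeries_C]

lemma exists_mul_mem_Aset {F : Type*} [Field F] {f : Khat F} (hf : f ∈ Kset F) :
    ∃ Q ∈ Aset F, Q ≠ 0 ∧ Q * f ∈ Aset F := by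
  obtain ⟨r, rfl⟩ := hf
  have key : ∀ (p : Polynomial F) (N : ℕ), p.natDegree ≤ N →
      HahnSeries.single (-(N : ℤ)) (1 : F) * algebraMap (RatFunc F) (Khat F)
        (algebraMap _ _ p) ∈ Aset F := by
    intro p N hN
    refine mem_Aset_iff.mpr fun i hi => ?_
    rw [algebraMap_ratFunc_algebraMap, HahnSeries.coeff_single_mul, one_mul, PowerSeries.coeff_coe,
      if_neg (by omega), Polynomial.coeff_coe]
    exact Polynomial.coeff_eq_zero_of_natDegree_lt (by omega)
  set N := max r.num.natDegree r.denom.natDegree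
  have hd : algebraMap (RatFunc F) (Khat F) (algebraMap _ _ r.denom) ≠ 0 := by
    simpa using r.denom_ne_zero
  refine ⟨_, key r.denom N (le_max_right _ _), mul_ne_zero (by simp) hd, ?_⟩
  have := key r.num N (le_max_left _ _)
  change _ * algebraMap (RatFunc F) (Khat F) r ∈ _
  conv in algebraMap (RatFunc F) (Khat F) r => rw [← r.num_div_denom]
  rwa [map_div₀, mul_assoc, mul_div_cancel₀ _ hd]

lemma ArtinPsi_mem_Kset_iff {F : Type*} [Field F] {f : Khat F} :
    ArtinPsi f ∈ Kset F ↔ f ∈ Kset F := by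
  have h := Aset_subset_Kset F (intPart_mem_Aset f⁻¹)
  rw [Kset_eq, SetLike.mem_coe] at h ⊢
  rw [ArtinPsi, fracPart]
  constructor
  · intro hf
    simpa using inv_mem (add_mem hf h)
  · exact fun hf => sub_mem (inv_mem hf) h

end RationalFunctions

lemma ArtinPsi_mem {ξ : Khat k} (hξ : ξ ∈ cK k) : ArtinPsi ξ ∈ XinvO k ∩ cK k :=
  ⟨mem_XinvO_iff.mpr (absInf_fracPart_lt_one _), mt ArtinPsi_mem_Kset_iff.mp hξ⟩

lemma digit_mem_AmK {ξ : Khat k} (hξ : ξ ∈ XinvO k ∩ cK k) (n : ℕ) : digit n ξ ∈ AmK k := by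
  induction n generalizing ξ with
  | zero =>
    have h0 : ξ ≠ 0 := by
      rintro rfl
      exact hξ.2 (Aset_subset_Kset k ⟨0, map_zero _⟩)
    have h1 : 1 < absInf ξ⁻¹ := by
      rw [absInf_inv]
      exact (one_lt_inv₀ (absInf_pos h0)).mpr (mem_XinvO_iff.mp hξ.1)
    refine mem_AmK_iff.mpr ⟨intPart_mem_Aset _, ?_⟩
    have : absInf (intPart ξ⁻¹ - ξ⁻¹) < absInf ξ⁻¹ := by
      rw [absInf_sub_comm]
      exact (absInf_fracPart_lt_one _).trans h1
    exact h1.trans_eq (absInf_eq_of_sub_lt this).symm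
  | succ n ih => exact ih (ArtinPsi_mem hξ.2)

/-- An element whose Artin digits are all nonconstant is irrational. -/
lemma not_mem_Kset_of_forall_digit_mem {ξ : Khat k} (h1 : absInf ξ < 1)
    (hd : ∀ n, digit n ξ ∈ AmK k) : ξ ∈ cK k := by
  intro hK
  obtain ⟨Q, hQ, hQ0, hQξ⟩ := exists_mul_mem_Aset hK
  have key : ∀ (n : ℕ) (ξ Q : Khat k), absInf ξ < 1 → (∀ n, digit n ξ ∈ AmK k) →
      Q ∈ Aset k → Q * ξ ∈ Aset k → absInf Q < (Fintype.card k : ℝ) ^ n → Q = 0 := by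
    intro n
    induction n with
    | zero =>
      intro ξ Q _ _ hQ _ hlt
      exact eq_zero_of_mem_Aset hQ (by simpa using hlt)
    | succ n ih =>
      intro ξ Q h1 hd hQ hQξ hlt
      have hξ : ξ ≠ 0 := by
        rintro rfl
        have := ne_zero_of_mem_AmK (hd 0)
        simp [digit, intPart] at this
      by_contra hQ0
      refine mul_ne_zero hQ0 hξ (ih (ArtinPsi ξ) (Q * ξ) (absInf_fracPart_lt_one _)
        (fun n => hd (n + 1)) hQξ ?_ ?_)
      · have : Q * ξ * ArtinPsi ξ = Q - Q * ξ * intPart ξ⁻¹ := by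
          rw [ArtinPsi, fracPart]
          field_simp
        rw [this]
        exact sub_mem_Aset hQ (mul_mem_Aset hQξ (intPart_mem_Aset _))
      · rw [absInf_mul]
        have h1' : absInf ξ ≤ (Fintype.card k : ℝ)⁻¹ := by
          simpa using (absInf_lt_zpow_add_one_iff (f := ξ) (n := -1)).mp (by simpa using h1)
        calc absInf Q * absInf ξ ≤ absInf Q * (Fintype.card k : ℝ)⁻¹ :=
              mul_le_mul_of_nonneg_left h1' (absInf_nonneg _)
          _ < (Fintype.card k : ℝ) ^ n := by
              rw [← div_eq_mul_inv, div_lt_iff₀ card_pos, ← pow_succ]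
              exact hlt
  obtain ⟨n, hn⟩ := pow_unbounded_of_one_lt (absInf Q) (one_lt_card (k := k))
  exact hQ0 (key n ξ Q h1 hd hQ hQξ hn)

lemma dist_eq_absInf (f g : Khat k) : dist f g = absInf (f - g) := rfl

/-- Around an irrational point the cylinders of the digit map are balls. -/
lemma forall_digit_eq_digit_iff {ξ η : Khat k} (hξ : ξ ∈ XinvO k ∩ cK k) (hη : absInf η < 1)
    (n : ℕ) : (∀ i < n, digit i η = digit i ξ) ↔
      absInf (η - ξ) < cylRadius n fun i => digit i ξ := by
  have hd : ∀ i < n, digit i ξ ∈ AmK k := fun i _ => digit_mem_AmK hξ i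
  have hξn := (forall_digit_eq_iff hd (mem_XinvO_iff.mp hξ.1)).mp fun _ _ => rfl
  rw [forall_digit_eq_iff hd hη]
  constructor <;> intro h
  · refine (absInf_sub_le_max_sub _ _ _).trans_lt (max_lt h ?_)
    rwa [absInf_sub_comm]
  · exact (absInf_sub_le_max_sub _ _ _).trans_lt (max_lt h hξn)

lemma absInf_sub_lt_pow_of_digit_eq {ξ η : Khat k} (hξ : ξ ∈ XinvO k ∩ cK k)
    (hη : absInf η < 1) {n : ℕ} (h : ∀ i < n, digit i η = digit i ξ) :
    absInf (η - ξ) < ((Fintype.card k : ℝ)⁻¹) ^ n :=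
  ((forall_digit_eq_digit_iff hξ hη n).mp h).trans_le (cylRadius_le fun i _ => digit_mem_AmK hξ i)

lemma eq_of_forall_digit_eq {ξ η : Khat k} (hξ : ξ ∈ XinvO k ∩ cK k)
    (hη : absInf η < 1) (h : ∀ i, digit i η = digit i ξ) : η = ξ := by
  by_contra hne
  obtain ⟨n, hn⟩ := exists_pow_lt_of_lt_one (absInf_pos (sub_ne_zero.mpr hne))
    (inv_lt_one_of_one_lt₀ (one_lt_card (k := k)))
  exact hn.not_gt (absInf_sub_lt_pow_of_digit_eq hξ hη fun i _ => h i)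

lemma eq_of_mem_Aset_of_absInf_sub_lt_one {a b : Khat k} (ha : a ∈ Aset k) (hb : b ∈ Aset k)
    (h : absInf (a - b) < 1) : a = b :=
  sub_eq_zero.mp (eq_zero_of_mem_Aset (sub_mem_Aset ha hb) h)

/-- The digit map, as a bijection. -/
def digitEquiv : ↥(XinvO k ∩ cK k) ≃ (ℕ → ↥(AmK k)) :=
  Equiv.ofBijective (fun ξ n => ⟨digit n ξ, digit_mem_AmK ξ.2 n⟩) <| by
    constructor
    · intro η ξ h
      exact Subtype.ext <| eq_of_forall_digit_eq ξ.2 (mem_XinvO_iff.mp η.2.1) fun i =>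
        congrArg Subtype.val (congrFun h i)
    · intro c
      obtain ⟨ξ, h1, hξ⟩ := exists_forall_digit_eq fun i => (c i).2
      exact ⟨⟨ξ, mem_XinvO_iff.mpr h1,
        not_mem_Kset_of_forall_digit_mem h1 fun n => (hξ n).symm ▸ (c n).2⟩,
        funext fun n => Subtype.ext (hξ n)⟩

lemma digitEquiv_apply (ξ : ↥(XinvO k ∩ cK k)) (n : ℕ) :
    (digitEquiv ξ n : Khat k) = digit n (ξ : Khat k) := rfl

lemma continuous_digit (n : ℕ) :
    Continuous fun ξ : ↥(XinvO k ∩ cK k) => digit n (ξ : Khat k) := by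
  rw [Metric.continuous_iff]
  intro ξ ε hε
  refine ⟨_, cylRadius_pos (n := n + 1) fun i _ => digit_mem_AmK ξ.2 i, fun η h => ?_⟩
  rw [(forall_digit_eq_digit_iff ξ.2 (mem_XinvO_iff.mp η.2.1) (n + 1)).mpr h n n.lt_succ_self,
    dist_self]
  exact hε

lemma continuous_digitEquiv_symm : Continuous (digitEquiv (k := k)).symm := by
  rw [Metric.continuous_iff']
  intro s ε hε
  obtain ⟨n, hn⟩ := exists_pow_lt_of_lt_one hε (inv_lt_one_of_one_lt₀ (one_lt_card (k := k)))
  have hev : ∀ᶠ t in nhds s, ∀ i ∈ Finset.range n, t i = s i := by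
    rw [Filter.eventually_all_finset]
    intro i _
    refine ((continuous_apply i).tendsto s).eventually (p := fun y => y = s i) ?_
    filter_upwards [Metric.ball_mem_nhds (s i) one_pos] with y hy
    exact Subtype.ext (eq_of_mem_Aset_of_absInf_sub_lt_one y.2.1 (s i).2.1 hy)
  filter_upwards [hev] with t ht
  refine (absInf_sub_lt_pow_of_digit_eq (n := n) (digitEquiv.symm s).2
    (mem_XinvO_iff.mp (digitEquiv.symm t).2.1) fun i hi => ?_).trans hn
  rw [← digitEquiv_apply, ← digitEquiv_apply, Equiv.apply_symm_apply, Equiv.apply_symm_apply,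
    ht i (Finset.mem_range.mpr hi)]

variable (k) in
/-- The digit map, as a homeomorphism. -/
def digitHomeomorph : ↥(XinvO k ∩ cK k) ≃ₜ (ℕ → ↥(AmK k)) where
  toEquiv := digitEquiv
  continuous_toFun := continuous_pi fun n => (continuous_digit n).subtype_mk _
  continuous_invFun := continuous_digitEquiv_symm

section Measure

lemma countable_Aset : (Aset k).Countable := by
  have : Countable (Polynomial k) := by
    rw [← Cardinal.mk_le_aleph0_iff]
    exact Polynomial.cardinalMk_le_max.trans (max_le (Cardinal.mk_le_aleph0) le_rfl)
  exact Set.countable_range _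

lemma countable_AmK : (AmK k).Countable := countable_Aset.mono Set.sdiff_subset

lemma countable_Kset : (Kset k).Countable := by
  refine (Set.Countable.image2 (countable_Aset (k := k)) countable_Aset
    fun P Q => Q⁻¹ * P).mono fun f hf => ?_
  obtain ⟨Q, hQ, hQ0, hQf⟩ := exists_mul_mem_Aset hf
  exact ⟨_, hQf, _, hQ, inv_mul_cancel_left₀ hQ0 f⟩

lemma XinvO_eq_ball : XinvO k = Metric.ball (0 : Khat k) 1 := by
  ext f
  rw [mem_XinvO_iff, Metric.mem_ball, dist_eq_absInf, sub_zero]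

lemma measurableSet_XinvO_inter_cK : MeasurableSet (XinvO k ∩ cK k) := by
  rw [XinvO_eq_ball]
  exact Metric.isOpen_ball.measurableSet.inter countable_Kset.measurableSet.compl

variable {μ : Measure (Khat k)}

lemma measure_ball_eq (hinv : ∀ x : Khat k, Measure.map (fun y => x + y) μ = μ)
    (y : Khat k) (r : ℝ) : μ (Metric.ball y r) = μ (Metric.ball 0 r) := by
  have hm : Continuous fun z : Khat k => y + z :=
    (Isometry.of_dist_eq fun a b => by
      rw [dist_eq_absInf, dist_eq_absInf, add_sub_add_left_eq_sub]).continuous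
  conv_lhs => rw [← hinv y, Measure.map_apply hm.measurable Metric.isOpen_ball.measurableSet]
  congr 1
  ext z
  simp [dist_eq_absInf]

lemma ball_zero_zpow_eq_iUnion (n : ℕ) :
    Metric.ball (0 : Khat k) ((Fintype.card k : ℝ) ^ (1 - (n : ℤ))) =
      ⋃ c : k, Metric.ball (HahnSeries.single (n : ℤ) c)
        ((Fintype.card k : ℝ) ^ (1 - ((n + 1 : ℕ) : ℤ))) := by
  rw [show 1 - (n : ℤ) = -((n : ℤ) - 1) by ring,
    show 1 - ((n + 1 : ℕ) : ℤ) = -(n : ℤ) by push_cast; ring]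
  ext f
  simp only [Set.mem_iUnion, Metric.mem_ball, dist_eq_absInf, sub_zero, absInf_lt_zpow_iff]
  constructor
  · intro h
    refine ⟨f.coeff n, fun i hi => ?_⟩
    rcases hi.eq_or_lt with rfl | hi
    · simp
    · rw [HahnSeries.coeff_sub, h i (by omega), HahnSeries.coeff_single_of_ne hi.ne, sub_zero]
  · rintro ⟨c, h⟩ i hi
    have := h i (by omega)
    rwa [HahnSeries.coeff_sub, HahnSeries.coeff_single_of_ne (by omega), sub_zero] at this

lemma measure_ball_zpow (hinv : ∀ x : Khat k, Measure.map (fun y => x + y) μ = μ)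
    (hO : μ (Oball k) = 1) (y : Khat k) (n : ℕ) :
    μ (Metric.ball y ((Fintype.card k : ℝ) ^ (1 - (n : ℤ)))) =
      ((Fintype.card k : ℝ≥0∞)⁻¹) ^ n := by
  rw [measure_ball_eq hinv]
  induction n with
  | zero =>
    rw [pow_zero, ← hO]
    congr 1
    ext f
    have := absInf_lt_zpow_add_one_iff (f := f) (n := 0)
    simpa [dist_eq_absInf, Oball] using this
  | succ n ih =>
    rw [ball_zero_zpow_eq_iUnion, measure_iUnion _ fun _ => Metric.isOpen_ball.measurableSet] at ih
    · simp only [measure_ball_eq hinv (HahnSeries.single _ _), tsum_fintype, Finset.sum_const,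
        Finset.card_univ, nsmul_eq_mul] at ih
      rw [pow_succ', ← ih, ← mul_assoc, ENNReal.inv_mul_cancel, one_mul]
      · simp
      · simp
    · intro c d hcd
      refine Set.disjoint_left.mpr fun f hc hd => hcd ?_
      rw [Metric.mem_ball, dist_eq_absInf, show 1 - ((n + 1 : ℕ) : ℤ) = -(n : ℤ) by
        push_cast; ring, absInf_lt_zpow_iff] at hc hd
      have hc := hc n le_rfl
      have hd := hd n le_rfl
      rw [HahnSeries.coeff_sub, HahnSeries.coeff_single_same, sub_eq_zero] at hc hd
      exact hc.symm.trans hd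

lemma measure_singleton_eq_zero (hinv : ∀ x : Khat k, Measure.map (fun y => x + y) μ = μ)
    (hO : μ (Oball k) = 1) (x : Khat k) : μ {x} = 0 := by
  refine le_antisymm (ge_of_tendsto' (ENNReal.tendsto_pow_atTop_nhds_zero_of_lt_one
    (r := (Fintype.card k : ℝ≥0∞)⁻¹) ?_) fun n => ?_) bot_le
  · exact ENNReal.inv_lt_one.mpr (by exact_mod_cast Fintype.one_lt_card (α := k))
  · rw [← measure_ball_zpow hinv hO x n]
    exact measure_mono (Set.singleton_subset_iff.mpr
      (Metric.mem_ball_self (zpow_pos card_pos _)))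

lemma measure_Kset_eq_zero (hinv : ∀ x : Khat k, Measure.map (fun y => x + y) μ = μ)
    (hO : μ (Oball k) = 1) : μ (Kset k) = 0 := by
  rw [← Set.biUnion_of_singleton (Kset k), measure_biUnion_null_iff countable_Kset]
  exact fun x _ => measure_singleton_eq_zero hinv hO x

lemma exists_cylRadius_eq {n : ℕ} {c : ℕ → Khat k} (hc : ∀ i < n, c i ∈ AmK k) :
    ∃ N : ℕ, cylRadius n c = (Fintype.card k : ℝ) ^ (-(N : ℤ)) := by
  have h1 := cylRadius_le_one hc
  have : ∃ z : ℤ, cylRadius n c = (Fintype.card k : ℝ) ^ (-z) := by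
    clear h1
    induction n with
    | zero => exact ⟨0, by simp [cylRadius]⟩
    | succ n ih =>
      obtain ⟨z, hz⟩ := ih fun i hi => hc i (by omega)
      refine ⟨z - 2 * (c n).order, ?_⟩
      rw [cylRadius] at hz ⊢
      rw [Finset.prod_range_succ, hz, absInf, if_neg (ne_zero_of_mem_AmK (hc n n.lt_succ_self)),
        ← zpow_natCast, ← zpow_mul, ← zpow_neg, ← zpow_add₀ card_pos.ne']
      congr 1
      push_cast
      ring
  obtain ⟨z, hz⟩ := this
  rw [hz, zpow_le_one_iff_right₀ one_lt_card] at h1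
  exact ⟨z.toNat, by rw [hz, Int.toNat_of_nonneg (by omega)]⟩

/-- The law of the digit sequence of a Haar-random element of `X⁻¹O`. -/
def digitLaw (μ : Measure (Khat k)) : Measure (ℕ → Khat k) :=
  Measure.map (fun f : Khat k => fun n : ℕ => digit n f)
    ((Fintype.card k : ℝ≥0∞) • μ.restrict (XinvO k ∩ cK k))

lemma aemeasurable_digits (μ : Measure (Khat k)) :
    AEMeasurable (fun f : Khat k => fun n : ℕ => digit n f)
      ((Fintype.card k : ℝ≥0∞) • μ.restrict (XinvO k ∩ cK k)) := by
  refine AEMeasurable.smul_measure (aemeasurable_pi_iff.mpr fun n => ?_) _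
  exact (continuousOn_iff_continuous_domRestrict.mpr (continuous_digit n)).aemeasurable
    measurableSet_XinvO_inter_cK

lemma measurableSet_forall_mem_eq (S : Finset ℕ) (c : ℕ → Khat k) :
    MeasurableSet {x : ℕ → Khat k | ∀ i ∈ S, x i = c i} := by
  simp only [Set.ofPred_forall]
  refine S.measurableSet_biInter fun i _ => ?_
  have : MeasurableSet ((fun x : ℕ → Khat k => x i) ⁻¹' {c i}) :=
    measurable_pi_apply i (measurableSet_singleton _)
  exact this

lemma ae_digitLaw_mem_AmK (μ : Measure (Khat k)) (j : ℕ) : ∀ᵐ x ∂digitLaw μ, x j ∈ AmK k := by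
  rw [digitLaw, ae_map_iff (aemeasurable_digits μ)
    (measurable_pi_apply j countable_AmK.measurableSet)]
  refine Measure.ae_smul_measure ?_ _
  exact ae_restrict_of_forall_mem measurableSet_XinvO_inter_cK fun f hf => digit_mem_AmK hf j

lemma digitLaw_range (hinv : ∀ x : Khat k, Measure.map (fun y => x + y) μ = μ)
    (hO : μ (Oball k) = 1) (n : ℕ) (c : ℕ → Khat k) :
    digitLaw μ {x : ℕ → Khat k | ∀ i ∈ Finset.range n, x i = c i} =
      ∏ i ∈ Finset.range n, nuE k (c i) := by
  by_cases hc : ∀ i < n, c i ∈ AmK k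
  · have h1 := cylRadius_le_one hc
    have hset : (fun f : Khat k => fun n : ℕ => digit n f) ⁻¹'
        {x : ℕ → Khat k | ∀ i ∈ Finset.range n, x i = c i} ∩ (XinvO k ∩ cK k) =
        Metric.ball (convergent n c) (cylRadius n c) \ Kset k := by
      ext f
      simp only [Set.mem_inter_iff, Set.mem_preimage, Set.mem_ofPred_eq, Finset.mem_range,
        Set.mem_sdiff, Metric.mem_ball, dist_eq_absInf, mem_XinvO_iff]
      constructor
      · rintro ⟨h, hf, hK⟩
        exact ⟨(forall_digit_eq_iff hc hf).mp h, hK⟩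
      · rintro ⟨h, hK⟩
        have hf : absInf f < 1 := by
          simpa using (absInf_add_le (f - convergent n c) (convergent n c)).trans_lt
            (max_lt (h.trans_le h1) (absInf_convergent_lt_one hc))
        exact ⟨(forall_digit_eq_iff hc hf).mpr h, hf, hK⟩
    obtain ⟨N, hN⟩ := exists_cylRadius_eq hc
    have hν : ∏ i ∈ Finset.range n, nuE k (c i) = ENNReal.ofReal (cylRadius n c) := by
      rw [cylRadius, ENNReal.ofReal_prod_of_nonneg fun _ _ => inv_nonneg.mpr (sq_nonneg _)]
      exact Finset.prod_congr rfl fun i hi => if_pos (hc i (Finset.mem_range.mp hi))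
    rw [digitLaw, Measure.map_apply_of_aemeasurable (aemeasurable_digits μ)
      (measurableSet_forall_mem_eq _ c), Measure.smul_apply,
      Measure.restrict_apply' measurableSet_XinvO_inter_cK, hset,
      measure_sdiff_null (measure_Kset_eq_zero hinv hO), hν, hN]
    have := measure_ball_zpow hinv hO (convergent n c) (N + 1)
    rw [show 1 - ((N + 1 : ℕ) : ℤ) = -(N : ℤ) by push_cast; ring] at this
    rw [this, smul_eq_mul, pow_succ', ← mul_assoc, ENNReal.mul_inv_cancel (by simp) (by simp),
      one_mul, zpow_neg, zpow_natCast, ENNReal.ofReal_inv_of_pos (pow_pos card_pos N),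
      ENNReal.ofReal_pow card_pos.le, ENNReal.ofReal_natCast, ENNReal.inv_pow]
  · push Not at hc
    obtain ⟨i, hi, hci⟩ := hc
    rw [Finset.prod_eq_zero (Finset.mem_range.mpr hi) (if_neg hci)]
    have h := ae_iff.mp (ae_digitLaw_mem_AmK μ i)
    refine measure_mono_null (fun x hx => ?_) h
    have hx : x i = c i := hx i (Finset.mem_range.mpr hi)
    change x i ∉ AmK k
    rwa [hx]

lemma digitLaw_eq_tsum_insert (μ : Measure (Khat k)) (S : Finset ℕ) {j : ℕ} (hj : j ∉ S)
    (c : ℕ → Khat k) :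
    digitLaw μ {x : ℕ → Khat k | ∀ i ∈ S, x i = c i} =
      ∑' a : AmK k, digitLaw μ
        {x : ℕ → Khat k | ∀ i ∈ insert j S, x i = Function.update c j (a : Khat k) i} := by
  have hmeas : ∀ a ∈ AmK k, MeasurableSet ((fun x : ℕ → Khat k => x j) ⁻¹' {a}) :=
    fun a _ => measurable_pi_apply j (measurableSet_singleton a)
  have h := tsum_measure_preimage_singleton
    (μ := (digitLaw μ).restrict {x : ℕ → Khat k | ∀ i ∈ S, x i = c i}) countable_AmK hmeas
  rw [Measure.restrict_apply' (measurableSet_forall_mem_eq S c), Set.inter_comm,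
    measure_inter_conull (show digitLaw μ ((fun x => x j) ⁻¹' AmK k)ᶜ = 0 from
      ae_digitLaw_mem_AmK μ j)] at h
  rw [← h]
  refine tsum_congr fun a => ?_
  rw [Measure.restrict_apply (hmeas a a.2)]
  congr 1
  ext x
  simp only [Set.mem_inter_iff, Set.mem_preimage, Set.mem_singleton_iff, Set.mem_ofPred_eq,
    Finset.forall_mem_insert, Function.update_self]
  refine and_congr_right fun _ => forall₂_congr fun i hi => ?_
  rw [Function.update_of_ne (ne_of_mem_of_not_mem hi hj)]

lemma tsum_nuE (hinv : ∀ x : Khat k, Measure.map (fun y => x + y) μ = μ)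
    (hO : μ (Oball k) = 1) : ∑' a : AmK k, nuE k (a : Khat k) = 1 := by
  have h := digitLaw_eq_tsum_insert μ ∅ (Finset.notMem_empty 0) 0
  have h0 := digitLaw_range hinv hO 0 0
  rw [Finset.range_zero, Finset.prod_empty] at h0
  rw [h0] at h
  rw [h]
  refine tsum_congr fun a => ?_
  have h1 := digitLaw_range hinv hO 1 (Function.update 0 0 (a : Khat k))
  rw [Finset.range_one, Finset.prod_singleton, Function.update_self] at h1
  exact h1.symm

lemma digitLaw_eq_prod (hinv : ∀ x : Khat k, Measure.map (fun y => x + y) μ = μ)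
    (hO : μ (Oball k) = 1) (S : Finset ℕ) (c : ℕ → Khat k) :
    digitLaw μ {x : ℕ → Khat k | ∀ i ∈ S, x i = c i} = ∏ i ∈ S, nuE k (c i) := by
  have key : ∀ T S : Finset ℕ,
      (∀ c : ℕ → Khat k, digitLaw μ {x : ℕ → Khat k | ∀ i ∈ T ∪ S, x i = c i} =
        ∏ i ∈ T ∪ S, nuE k (c i)) →
      ∀ c : ℕ → Khat k, digitLaw μ {x : ℕ → Khat k | ∀ i ∈ S, x i = c i} =
        ∏ i ∈ S, nuE k (c i) := by
    intro T
    induction T using Finset.induction_on with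
    | empty => simp only [Finset.empty_union, imp_self, implies_true]
    | insert j T _ ih =>
      intro S h
      refine ih S ?_
      rw [Finset.insert_union] at h
      by_cases hj : j ∈ T ∪ S
      · rwa [Finset.insert_eq_self.mpr hj] at h
      intro c
      rw [digitLaw_eq_tsum_insert μ _ hj c]
      have : ∀ a : AmK k, digitLaw μ
          {x : ℕ → Khat k | ∀ i ∈ insert j (T ∪ S), x i = Function.update c j (a : Khat k) i} =
          nuE k (a : Khat k) * ∏ i ∈ T ∪ S, nuE k (c i) := by
        intro a
        rw [h, Finset.prod_insert hj, Function.update_self]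
        congr 1
        exact Finset.prod_congr rfl fun i hi => by
          rw [Function.update_of_ne (ne_of_mem_of_not_mem hi hj)]
      rw [tsum_congr this, ENNReal.tsum_mul_right, tsum_nuE hinv hO, one_mul]
  refine key (Finset.range (S.sup id + 1)) S (fun c => ?_) c
  have hS : S ⊆ Finset.range (S.sup id + 1) := fun i hi =>
    Finset.mem_range.mpr (Nat.lt_succ_of_le (Finset.le_sup (f := id) hi))
  rw [Finset.union_eq_left.mpr hS]
  exact digitLaw_range hinv hO _ c

end Measure

/-- The digit map `D(ξ) = (aₙ(ξ))_(n≥1)` is a homeomorphism from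
`X⁻¹O ∩ ᶜK` onto `(A∖k)^ℕ` conjugating `Ψ` with the one-sided shift, and it pushes the
probability measure `q·μ|_(X⁻¹O ∩ ᶜK)` to the Bernoulli measure `ν^⊗ℕ`: the Artin continued
fraction digits of a Haar-random element are i.i.d. of law `ν`. -/
theorem statement_16 (k : Type*) [Field k] [Fintype k] (μ : MeasureTheory.Measure (Khat k))
    (hinv : ∀ x : Khat k, MeasureTheory.Measure.map (fun y => x + y) μ = μ)
    (hO : μ (Oball k) = 1) :
    (∃ D : ↥(XinvO k ∩ cK k) ≃ₜ (ℕ → ↥(AmK k)),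
      (∀ (ξ : ↥(XinvO k ∩ cK k)) (n : ℕ), (D ξ n : Khat k) = digit n (ξ : Khat k)) ∧
      (∀ Ψs : ↥(XinvO k ∩ cK k) → ↥(XinvO k ∩ cK k),
        (∀ ξ, (Ψs ξ : Khat k) = ArtinPsi (ξ : Khat k)) →
        ∀ (ξ : ↥(XinvO k ∩ cK k)) (n : ℕ), D (Ψs ξ) n = D ξ (n + 1))) ∧
    (∀ (S : Finset ℕ) (c : ℕ → Khat k),
      MeasureTheory.Measure.map (fun f : Khat k => fun n : ℕ => digit n f)
          ((Fintype.card k : ℝ≥0∞) • μ.restrict (XinvO k ∩ cK k))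
          {x : ℕ → Khat k | ∀ i ∈ S, x i = c i}
        = ∏ i ∈ S, nuE k (c i)) := by
  refine ⟨⟨digitHomeomorph k, fun ξ n => rfl, ?_⟩, fun S c => digitLaw_eq_prod hinv hO S c⟩
  intro Ψs hΨ ξ n
  refine Subtype.ext ?_
  change digit n (Ψs ξ : Khat k) = digit (n + 1) (ξ : Khat k)
  rw [hΨ]
  rfl

end ArtinCoding
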